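/- arXiv:1704.01410 — 2 statements merged into one kernel-verified Lean document; each statement's English description precedes it below -/
import Mathlib

section
/- Let X be a nonempty compact topological space, let f : X → X be a continuous map, let d be a real number with d > 1, and let λ : X → ℝ be a continuous function. Then there exists a unique continuous function h : X → ℝ such that h(f(x)) = d·h(x) − λ(x) for all x ∈ X. -/
/-- The operator `h ↦ d⁻¹ • (h ∘ f + lam)` on continuous functions on a compact space contracts
the sup distance by `d⁻¹`. -/
theorem ContinuousMap.contractingWith_inv_smul_comp_add
    {X : Type*} [TopologicalSpace X] [CompactSpace X] (f : C(X, X)) {d : ℝ} (hd : 1 < d)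
    (lam : C(X, ℝ)) :
    ContractingWith (Real.toNNReal d⁻¹) fun h : C(X, ℝ) => d⁻¹ • (h.comp f + lam) := by
  have hd' : 0 ≤ d⁻¹ := by positivity
  refine ⟨Real.toNNReal_lt_one.2 (inv_lt_one_of_one_lt₀ hd), LipschitzWith.of_dist_le_mul ?_⟩
  intro h k
  rw [Real.coe_toNNReal _ hd', ContinuousMap.dist_le (by positivity)]
  intro x
  have hx : dist (h (f x)) (k (f x)) ≤ dist h k := ContinuousMap.dist_apply_le_dist (f x)
  change dist (d⁻¹ • (h (f x) + lam x)) (d⁻¹ • (k (f x) + lam x)) ≤ _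
  rw [dist_smul₀, dist_add_right, Real.norm_of_nonneg hd']
  exact mul_le_mul_of_nonneg_left hx hd'

/-- Existence and uniqueness of a continuous function `h` on a nonempty compact
space satisfying the functional equation `h (f x) = d * h x - lam x`. -/
theorem canonical_green_correction_exists_unique
    {X : Type*} [TopologicalSpace X] [CompactSpace X] [Nonempty X]
    (f : X → X) (hf : Continuous f) (d : ℝ) (hd : 1 < d)
    (lam : X → ℝ) (hlam : Continuous lam) :
    ∃! h : X → ℝ, Continuous h ∧ ∀ x, h (f x) = d * h x - lam x := by
  have hT := ContinuousMap.contractingWith_inv_smul_comp_add ⟨f, hf⟩ hd ⟨lam, hlam⟩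
  have hd0 : d ≠ 0 := by positivity
  have fixed_iff (h : C(X, ℝ)) :
      Function.IsFixedPt (fun h : C(X, ℝ) => d⁻¹ • (h.comp ⟨f, hf⟩ + ⟨lam, hlam⟩)) h ↔
        ∀ x, h (f x) = d * h x - lam x := by
    rw [Function.IsFixedPt, ContinuousMap.ext_iff]
    refine forall_congr' fun x => ?_
    change d⁻¹ * (h (f x) + lam x) = h x ↔ _
    rw [inv_mul_eq_iff_eq_mul₀ hd0, eq_sub_iff_add_eq]
  refine ⟨_, ⟨map_continuous _, (fixed_iff _).1 hT.fixedPoint_isFixedPt⟩, ?_⟩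
  rintro k ⟨hk, hkf⟩
  exact congrArg DFunLike.coe (hT.fixedPoint_unique ((fixed_iff ⟨k, hk⟩).2 hkf))
end

section
/- Let V be a vector space over ℚ, let x, x₁, …, x_r be elements of V, and let a₁, …, a_r be real numbers such that, in the scalar extension ℝ ⊗_ℚ V, one has 1 ⊗ x = a₁·(1 ⊗ x₁) + ⋯ + a_r·(1 ⊗ x_r). Then for every ε > 0 there exist rational numbers a′₁, …, a′_r such that x = a′₁·x₁ + ⋯ + a′_r·x_r in V and |a′ᵢ − aᵢ| ≤ ε for all i = 1, …, r. -/
open TensorProduct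

/-- Rational approximation of real linear relations: if `1 ⊗ x = ∑ aᵢ • (1 ⊗ xᵢ)`
in `ℝ ⊗[ℚ] V` with real coefficients `aᵢ`, then for every `ε > 0` there are
rational coefficients `a'ᵢ` with `x = ∑ a'ᵢ • xᵢ` in `V` and `|a'ᵢ - aᵢ| ≤ ε`. -/
theorem rational_approx_of_real_relation
    {V : Type*} [AddCommGroup V] [Module ℚ V] {r : ℕ}
    (x : V) (xi : Fin r → V) (a : Fin r → ℝ)
    (h : ((1 : ℝ) ⊗ₜ[ℚ] x : ℝ ⊗[ℚ] V) = ∑ i, a i • ((1 : ℝ) ⊗ₜ[ℚ] xi i)) :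
    ∀ ε > 0, ∃ a' : Fin r → ℚ,
      x = ∑ i, (a' i : ℚ) • xi i ∧ ∀ i, |(a' i : ℝ) - a i| ≤ ε := by
  intro ε hε
  have hsum : ∑ i : Option (Fin r), (i.elim (-x) xi) ⊗ₜ[ℚ] (i.elim 1 a : ℝ) = (0 : V ⊗[ℚ] ℝ) := by
    have h' := congrArg (TensorProduct.comm ℚ ℝ V) h
    simp only [TensorProduct.smul_tmul', smul_eq_mul, mul_one, map_sum,
      TensorProduct.comm_tmul] at h'
    simp [Fintype.sum_option, TensorProduct.neg_tmul, h']
  obtain ⟨k, A, y, hy, hA⟩ :=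
    TensorProduct.vanishesTrivially_of_sum_tmul_eq_zero_of_rTensor_injective ℚ
      (Module.Flat.rTensor_preserves_injective_linearMap _ (Submodule.injective_subtype _)) hsum
  have hy1 : ∑ j, (A none j : ℝ) * y j = 1 := by
    simpa [Rat.smul_def] using (hy none).symm
  have hya (i : Fin r) : ∑ j, (A (some i) j : ℝ) * y j = a i := by
    simpa [Rat.smul_def] using (hy (some i)).symm
  have hAx (j : Fin k) : A none j • x = ∑ i, A (some i) j • xi i := by
    have := hA j
    simp only [Fintype.sum_option, Option.elim, smul_neg] at this
    exact neg_add_eq_zero.mp this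
  have hcont (i : Option (Fin r)) : Continuous fun z : Fin k → ℝ ↦ ∑ j, (A i j : ℝ) * z j := by
    fun_prop
  have hne : ∀ᶠ z : Fin k → ℝ in nhds y, ∑ j, (A none j : ℝ) * z j ≠ 0 :=
    ContinuousAt.eventually_ne (hcont none).continuousAt (by simp [hy1])
  have hclose : ∀ᶠ z : Fin k → ℝ in nhds y, ∀ i,
      |(∑ j, (A (some i) j : ℝ) * z j) / (∑ j, (A none j : ℝ) * z j) - a i| < ε := by
    refine Filter.eventually_all.mpr fun i ↦ ?_
    have hc : ContinuousAt (fun z : Fin k → ℝ ↦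
        |(∑ j, (A (some i) j : ℝ) * z j) / (∑ j, (A none j : ℝ) * z j) - a i|) y := by
      refine ContinuousAt.abs (ContinuousAt.sub (ContinuousAt.div (hcont _).continuousAt
        (hcont none).continuousAt ?_) continuousAt_const)
      simp [hy1]
    exact hc.eventually_lt_const (by simpa [hy1, hya] using hε)
  have hdense : DenseRange (Pi.map fun (_ : Fin k) (q : ℚ) ↦ (q : ℝ)) :=
    DenseRange.piMap fun _ ↦ Rat.denseRange_cast
  obtain ⟨_, ⟨hz, hz'⟩, q, rfl⟩ := mem_closure_iff_nhds.mp (hdense y) _ (hne.and hclose)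
  simp only [Pi.map_apply] at hz hz'
  have hs : ∑ j, A none j * q j ≠ 0 := by exact_mod_cast hz
  refine ⟨fun i ↦ (∑ j, A (some i) j * q j) / ∑ j, A none j * q j, ?_, fun i ↦ ?_⟩
  · have hrel : (∑ j, A none j * q j) • x = ∑ i, (∑ j, A (some i) j * q j) • xi i := by
      simp only [Finset.sum_smul]
      rw [Finset.sum_comm]
      refine Finset.sum_congr rfl fun j _ ↦ ?_
      simp only [mul_comm _ (q j), mul_smul, hAx, Finset.smul_sum]
    simp only [div_eq_inv_mul, mul_smul, ← Finset.smul_sum, ← hrel]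
    rw [inv_smul_smul₀ hs]
  · exact_mod_cast (hz' i).le
end
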